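/- Let (A,∘,[·,·]) be a Gel'fand-Dorfman bialgebra over K of codimension 1 in a vector space E. Assume the sub-adjacent Lie algebra g(A) (with bracket a∘b − b∘a) is perfect, i.e. A is spanned by elements a∘b − b∘a, and that every quasicentroid of the Novikov algebra (A,∘) is inner. Then Extd(E,A) is in bijection with the disjoint union (SF1(A)/≡) ⊔ (SF3(A)/≡), where: SF1(A) is the set of GD flag datums with p = q = η = 0 and T = 0, written (S,a1,k,D), with (S,a1,k,D) ≡ (S',a1',k',D') iff there exists (a0,β) ∈ A × K* with S(a) = a0∘a + βS'(a) for all a, a∘a0 = 0 for all a, a1 = a0∘a0 + βS'(a0) + β²a1' − k a0, k = βk', and D(a) = βD'(a) + [a0,a] for all a; and SF3(A) is the set of GD flag datums with p = 0, T = 0, k = 0 and q ≠ 0, written (q,S,a1,η,D), with (q,S,a1,η,D) ≡ (q',S',a1',η',D') iff q = q', η = η' and there exists (a0,β) ∈ A × K* with S(a) = a0∘a + βS'(a) − q(a)a0 for all a, a∘a0 = 0 for all a, a1 = a0∘a0 + βS'(a0) + β²a1', q(a0) = 0, and D(a) = βD'(a) + [a0,a] − η(a)a0 for all a. -/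

import Mathlib

namespace GDExt

def IsNovikov {M : Type*} [AddCommGroup M] (mul : M → M → M) : Prop :=
  (∀ a b c, mul (mul a b) c - mul a (mul b c) = mul (mul b a) c - mul b (mul a c)) ∧
  ∀ a b c, mul (mul a b) c = mul (mul a c) b

def IsLieBracket {M : Type*} [AddCommGroup M] (br : M → M → M) : Prop :=
  (∀ a, br a a = 0) ∧ ∀ a b c, br a (br b c) = br (br a b) c + br b (br a c)

def IsGD {M : Type*} [AddCommGroup M] (mul br : M → M → M) : Prop :=
  IsNovikov mul ∧ IsLieBracket br ∧
  ∀ a b c, br a (mul b c) - br c (mul b a) + mul (br b a) c - mul (br b c) a - mul b (br a c) = 0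

variable {K : Type*} [Field K]
variable {A V : Type*} [AddCommGroup A] [Module K A] [AddCommGroup V] [Module K V]

/-- First component bilinear product of the unified product `A ♮ V`. -/
def uniMul (circ : A →ₗ[K] A →ₗ[K] A) (lA rA : A →ₗ[K] Module.End K V)
    (lV rV : V →ₗ[K] Module.End K A) (f : V →ₗ[K] V →ₗ[K] A)
    (st : V →ₗ[K] V →ₗ[K] V) : A × V → A × V → A × V :=
  fun p q =>
    (circ p.1 q.1 + lV p.2 q.1 + rV q.2 p.1 + f p.2 q.2,
     st p.2 q.2 + lA p.1 q.2 + rA q.1 p.2)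

/-- Bracket of the unified product `A ♮ V`. -/
def uniBr (brk : A →ₗ[K] A →ₗ[K] A) (tl : V →ₗ[K] A →ₗ[K] V) (tr : V →ₗ[K] A →ₗ[K] A)
    (hm : V →ₗ[K] V →ₗ[K] A) (vbr : V →ₗ[K] V →ₗ[K] V) : A × V → A × V → A × V :=
  fun p q =>
    (brk p.1 q.1 + tr p.2 q.1 - tr q.2 p.1 + hm p.2 q.2,
     vbr p.2 q.2 + tl p.2 q.1 - tl q.2 p.1)

end GDExt

namespace GDExt

variable (K : Type*) [Field K]
variable (A : Type*) [AddCommGroup A] [Module K A]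

/-- The data of a Gel'fand-Dorfman flag datum. -/
structure FlagData where
  p : A →ₗ[K] K
  q : A →ₗ[K] K
  S : A →ₗ[K] A
  T : A →ₗ[K] A
  a1 : A
  k : K
  eta : A →ₗ[K] K
  D : A →ₗ[K] A

variable {K A}

/-- Conditions (FN1)-(FN10), (TD1)-(TD2) and (GF1)-(GF6) for a GD flag datum of the
GD bialgebra `(A, circ, brk)`. -/
def IsFlagDatum (circ brk : A →ₗ[K] A →ₗ[K] A) (d : FlagData K A) : Prop :=
  -- (FN1)
  (∀ a b : A, d.p (circ a b) = d.p (circ b a)) ∧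
  (∀ a b : A, d.q (circ a b) = d.q a * d.q b) ∧
  -- (FN2)
  (∀ a b : A, d.S (circ a b) = circ (d.S a) b + circ a (d.S b) + (d.q a - d.p a) • d.S b
      + d.q b • d.T a - circ (d.T a) b) ∧
  -- (FN3)
  (∀ a b : A, d.T (circ a b) - d.T (circ b a)
      = d.p b • d.T a - d.p a • d.T b + circ a (d.T b) - circ b (d.T a)) ∧
  -- (FN4)
  (∀ a : A, d.T (d.T a) = d.T (d.S a) - d.S (d.T a) + circ a d.a1
      + (d.q a - 2 * d.p a) • d.a1 + d.k • d.T a) ∧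
  -- (FN5)
  (∀ a : A, d.p (d.S a) - d.p (d.T a) = d.q (d.T a) + d.k * (d.p a - d.q a)) ∧
  -- (FN6)
  (∀ a b : A, circ (d.S a) b + d.q a • d.S b = circ (d.S b) a + d.q b • d.S a) ∧
  -- (FN7)
  (∀ a b : A, d.T (circ a b) = circ (d.T a) b + d.p a • d.S b) ∧
  -- (FN8)
  (∀ a b : A, d.p (circ a b) = d.p a * d.q b) ∧
  -- (FN9)
  (∀ a : A, d.T (d.S a) = circ d.a1 a + d.k • d.S a - d.q a • d.a1) ∧
  -- (FN10)
  (∀ a : A, d.p (d.S a) = 0) ∧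
  -- (TD1)
  (∀ a b : A, d.eta (brk a b) = 0) ∧
  -- (TD2)
  (∀ a b : A, d.D (brk a b) = brk (d.D a) b + brk a (d.D b) + d.eta a • d.D b - d.eta b • d.D a) ∧
  -- (GF1)
  (∀ a b : A, brk a (d.T b) - d.p b • d.D a - d.D (circ b a) + d.T (brk b a)
      + circ (d.D b) a + d.eta b • d.S a + circ b (d.D a) + d.eta a • d.T b = 0) ∧
  -- (GF2)
  (∀ a b : A, d.p (brk b a) + d.eta b * d.q a - d.eta (circ b a) = 0) ∧
  -- (GF3)
  (∀ a b : A, brk a (d.S b) - d.q b • d.D a - brk b (d.S a) + d.q a • d.D b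
      + circ (d.D a) b + d.eta a • d.S b - circ (d.D b) a - d.eta b • d.S a
      - d.S (brk a b) = 0) ∧
  -- (GF4)
  (∀ a b : A, d.q (brk a b) = 0) ∧
  -- (GF5)
  (∀ a : A, brk a d.a1 - d.k • d.D a - d.D (d.S a) + d.T (d.D a)
      + (2 * d.eta a) • d.a1 + d.S (d.D a) = 0) ∧
  -- (GF6)
  (∀ a : A, d.k * d.eta a - d.eta (d.S a) + d.p (d.D a) + d.q (d.D a) = 0)

end GDExt

namespace GDExt

variable {K E : Type*} [Field K] [AddCommGroup E] [Module K E]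

/-- The GD bialgebra structures on `E` containing the GD bialgebra `(A, circ, brk)`
as a subalgebra (i.e. restricting to the given operations on `A`). -/
def GDStrOn (A : Submodule K E) (circ brk : ↥A →ₗ[K] ↥A →ₗ[K] ↥A) : Type _ :=
  {s : (E →ₗ[K] E →ₗ[K] E) × (E →ₗ[K] E →ₗ[K] E) //
    IsGD (fun u v => s.1 u v) (fun u v => s.2 u v) ∧
    ∀ a b : ↥A, s.1 a b = ((circ a b : ↥A) : E) ∧ s.2 a b = ((brk a b : ↥A) : E)}

/-- Equivalence of GD bialgebra structures on `E` containing `A` as a subalgebra: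
there is a GD bialgebra isomorphism whose restriction to `A` is the identity. -/
def GDStrEquiv (A : Submodule K E) (circ brk : ↥A →ₗ[K] ↥A →ₗ[K] ↥A)
    (s s' : GDStrOn A circ brk) : Prop :=
  ∃ φ : E ≃ₗ[K] E,
    (∀ u v : E, φ (s.1.1 u v) = s'.1.1 (φ u) (φ v)) ∧
    (∀ u v : E, φ (s.1.2 u v) = s'.1.2 (φ u) (φ v)) ∧
    (∀ a : ↥A, φ (a : E) = (a : E))

end GDExt

namespace GDExt

section Extension

variable {K E : Type*} [Field K] [AddCommGroup E] [Module K E]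

/-- Coordinates on `E` with respect to the decomposition `E = A ⊕ K x`. -/
structure Splitting (A : Submodule K E) (x : E) where
  /-- The component in `A`. -/
  fst : E →ₗ[K] A
  /-- The coefficient of `x`. -/
  snd : E →ₗ[K] K
  eq_add (u : E) : u = (fst u : E) + snd u • x
  fst_coe (a : A) : fst (a : E) = a
  snd_coe (a : A) : snd (a : E) = 0
  fst_self : fst x = 0
  snd_self : snd x = 1

attribute [simp] Splitting.fst_coe Splitting.snd_coe Splitting.fst_self Splitting.snd_self

variable {A : Submodule K E} {x : E}

theorem nonempty_splitting (hx : x ∉ A) (hc : IsCompl A (K ∙ x)) :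
    Nonempty (Splitting A x) := by
  have hx0 : x ≠ 0 := fun h => hx (h ▸ A.zero_mem)
  let e := LinearEquiv.toSpanNonzeroSingleton K E x hx0
  refine ⟨{
    fst := A.projectionOnto (K ∙ x) hc
    snd := e.symm.toLinearMap ∘ₗ (K ∙ x).projectionOnto A hc.symm
    eq_add := fun u => ?_
    fst_coe := fun a => by simp
    snd_coe := fun a => by simp
    fst_self := ?_
    snd_self := ?_ }⟩
  · have h1 : e.symm ((K ∙ x).projectionOnto A hc.symm u) • x =
        ((K ∙ x).projectionOnto A hc.symm u : E) :=
      congrArg Subtype.val (e.apply_symm_apply ((K ∙ x).projectionOnto A hc.symm u))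
    simp [h1, Submodule.projection_add_projection_eq_self]
  · exact (Submodule.projectionOnto_apply_eq_zero_iff hc).2 (Submodule.mem_span_singleton_self x)
  · have h : (K ∙ x).projectionOnto A hc.symm x = e 1 := by
      have := Submodule.projectionOnto_apply_left hc.symm
        ⟨x, Submodule.mem_span_singleton_self x⟩
      rw [this]
      ext
      simp [e]
    simp [h]

namespace Splitting

theorem ext_iff' (P : Splitting A x) {u v : E} :
    u = v ↔ P.fst u = P.fst v ∧ P.snd u = P.snd v :=
  ⟨fun h => by simp [h], fun h => by rw [P.eq_add u, P.eq_add v, h.1, h.2]⟩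

/-- The coordinates with respect to `x - b` for `b ∈ A`. -/
def shift (P : Splitting A x) (b : A) : Splitting A (x - (b : E)) where
  fst := P.fst + P.snd.smulRight b
  snd := P.snd
  eq_add u := by
    conv_lhs => rw [P.eq_add u]
    simp only [LinearMap.add_apply, LinearMap.smulRight_apply, Submodule.coe_add,
      Submodule.coe_smul]
    module
  fst_coe a := by simp
  snd_coe a := by simp
  fst_self := by simp
  snd_self := by simp

theorem linearMap_ext₂ (P : Splitting A x) {f g : E →ₗ[K] E →ₗ[K] E}
    (hab : ∀ a b : A, f a b = g a b) (hax : ∀ a : A, f a x = g a x)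
    (hxa : ∀ a : A, f x a = g x a) (hxx : f x x = g x x) (u v : E) : f u v = g u v := by
  rw [P.eq_add u, P.eq_add v]
  simp only [map_add, map_smul, LinearMap.add_apply, LinearMap.smul_apply, hab, hax, hxa, hxx]

/-- The automorphism of `E` fixing `A` and sending `x` to `b + β x`. -/
def affineEquiv (P : Splitting A x) (b : A) {β : K} (hβ : β ≠ 0) : E ≃ₗ[K] E :=
  LinearEquiv.ofLinearMap
    (A.subtype ∘ₗ P.fst + P.snd.smulRight ((b : E) + β • x))
    (A.subtype ∘ₗ P.fst + P.snd.smulRight (β⁻¹ • (x - (b : E))))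
    (by
      ext u
      conv_rhs => rw [P.eq_add u]
      simp [smul_smul, hβ])
    (by
      ext u
      conv_rhs => rw [P.eq_add u]
      simp [smul_smul, hβ, smul_sub])

@[simp]
theorem affineEquiv_coe (P : Splitting A x) (b : A) {β : K} (hβ : β ≠ 0) (a : A) :
    P.affineEquiv b hβ (a : E) = a := by
  simp [affineEquiv]

@[simp]
theorem affineEquiv_self (P : Splitting A x) (b : A) {β : K} (hβ : β ≠ 0) :
    P.affineEquiv b hβ x = (b : E) + β • x := by
  simp [affineEquiv]

end Splitting

variable {circ brk : A →ₗ[K] A →ₗ[K] A}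

theorem isFlagDatum_of_eq_zero_iff (S D : A →ₗ[K] A) (a1 : A) (k : K) :
    IsFlagDatum circ brk ⟨0, 0, S, 0, a1, k, 0, D⟩ ↔
      (∀ a b, S (circ a b) = circ (S a) b + circ a (S b)) ∧
      (∀ a, circ a a1 = 0) ∧
      (∀ a b, circ (S a) b = circ (S b) a) ∧
      (∀ a, circ a1 a + k • S a = 0) ∧
      (∀ a b, D (brk a b) = brk (D a) b + brk a (D b)) ∧
      (∀ a b, D (circ b a) = circ (D b) a + circ b (D a)) ∧
      (∀ a b, brk a (S b) - brk b (S a) + circ (D a) b - circ (D b) a - S (brk a b) = 0) ∧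
      (∀ a, brk a a1 - k • D a - D (S a) + S (D a) = 0) := by
  have h (a b : A) : -D (circ b a) + circ (D b) a + circ b (D a) = 0 ↔
      D (circ b a) = circ (D b) a + circ b (D a) := by
    rw [add_assoc, neg_add_eq_zero]
  simp [IsFlagDatum, h, eq_comm (a := (0 : A))]

/-- The product on `E` determined by `x ∘ a = S a`, `a ∘ x = 0` and `x ∘ x = a1 + k x`. -/
def extMul (P : Splitting A x) (circ : A →ₗ[K] A →ₗ[K] A) (d : FlagData K A) :
    E →ₗ[K] E →ₗ[K] E :=
  LinearMap.mk₂ K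
    (fun u v => ((circ (P.fst u) (P.fst v) + P.snd u • d.S (P.fst v)
      + (P.snd u * P.snd v) • d.a1 : A) : E) + (d.k * (P.snd u * P.snd v)) • x)
    (fun u u' v => by simp; module) (fun c u v => by simp; module)
    (fun u v v' => by simp; module) (fun c u v => by simp; module)

/-- The bracket on `E` determined by `[x, a] = D a`. -/
def extBr (P : Splitting A x) (brk : A →ₗ[K] A →ₗ[K] A) (d : FlagData K A) :
    E →ₗ[K] E →ₗ[K] E :=
  LinearMap.mk₂ K
    (fun u v => ((brk (P.fst u) (P.fst v) + P.snd u • d.D (P.fst v)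
      - P.snd v • d.D (P.fst u) : A) : E))
    (fun u u' v => by simp; module) (fun c u v => by simp; module)
    (fun u v v' => by simp; module) (fun c u v => by simp; module)

section

variable (P : Splitting A x) (d : FlagData K A) (u v : E)

@[simp]
theorem fst_extMul : P.fst (extMul P circ d u v) =
    circ (P.fst u) (P.fst v) + P.snd u • d.S (P.fst v) + (P.snd u * P.snd v) • d.a1 := by
  simp only [extMul, LinearMap.mk₂_apply, map_add, map_smul, P.fst_coe, P.fst_self, smul_zero,
    add_zero]

@[simp]
theorem snd_extMul : P.snd (extMul P circ d u v) = d.k * (P.snd u * P.snd v) := by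
  simp only [extMul, LinearMap.mk₂_apply, map_add, map_smul, P.snd_coe, P.snd_self, smul_eq_mul,
    mul_one, zero_add]

@[simp]
theorem fst_extBr : P.fst (extBr P brk d u v) =
    brk (P.fst u) (P.fst v) + P.snd u • d.D (P.fst v) - P.snd v • d.D (P.fst u) := by
  simp only [extBr, LinearMap.mk₂_apply, P.fst_coe]

@[simp]
theorem snd_extBr : P.snd (extBr P brk d u v) = 0 := by
  simp only [extBr, LinearMap.mk₂_apply, P.snd_coe]

end

theorem brk_swap (hGD : IsGD (fun a b => circ a b) (fun a b => brk a b)) (a b : A) :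
    brk a b = -brk b a := by
  have h := hGD.2.1.1 (a + b)
  have ha := hGD.2.1.1 a
  have hb := hGD.2.1.1 b
  simp only [map_add, LinearMap.add_apply] at h ha hb
  rw [ha, hb] at h
  linear_combination (norm := module) h

theorem isGD_ext (P : Splitting A x) (hGD : IsGD (fun a b => circ a b) (fun a b => brk a b))
    {S D : A →ₗ[K] A} {a1 : A} {k : K}
    (hd : IsFlagDatum circ brk ⟨0, 0, S, 0, a1, k, 0, D⟩) :
    IsGD (fun u v => extMul P circ ⟨0, 0, S, 0, a1, k, 0, D⟩ u v)
      (fun u v => extBr P brk ⟨0, 0, S, 0, a1, k, 0, D⟩ u v) := by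
  obtain ⟨h1, h2, h3, h4, h5, h6, h7, h8⟩ := (isFlagDatum_of_eq_zero_iff ..).1 hd
  have hsw := brk_swap hGD
  obtain ⟨⟨n1, n2⟩, ⟨l1, l2⟩, g⟩ := hGD
  simp only at n1 n2 l1 l2 g
  refine ⟨⟨fun u v w => ?_, fun u v w => ?_⟩, ⟨fun u => ?_, fun u v w => ?_⟩, fun u v w => ?_⟩ <;>
    rw [P.ext_iff'] <;> constructor <;>
    simp only [map_add, map_sub, map_smul, map_zero, fst_extMul, snd_extMul, fst_extBr, snd_extBr,
      LinearMap.add_apply, LinearMap.sub_apply, LinearMap.smul_apply, zero_smul, mul_zero,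
      zero_mul, sub_zero, add_zero, h2]
  · linear_combination (norm := module) n1 (P.fst u) (P.fst v) (P.fst w)
      - P.snd u • h1 (P.fst v) (P.fst w) + P.snd v • h1 (P.fst u) (P.fst w)
  · ring
  · linear_combination (norm := module) n2 (P.fst u) (P.fst v) (P.fst w)
      + P.snd u • h3 (P.fst v) (P.fst w) + (P.snd u * P.snd v) • h4 (P.fst w)
      - (P.snd u * P.snd w) • h4 (P.fst v)
  · ring
  · linear_combination (norm := module) l1 (P.fst u)
  · linear_combination (norm := module) l2 (P.fst u) (P.fst v) (P.fst w)
      + P.snd u • h5 (P.fst v) (P.fst w) - P.snd v • h5 (P.fst u) (P.fst w)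
      + P.snd w • (h5 (P.fst u) (P.fst v) + hsw (P.fst v) (D (P.fst u)))
  · linear_combination (norm := module) g (P.fst u) (P.fst v) (P.fst w)
      - P.snd w • h6 (P.fst u) (P.fst v) + P.snd u • h6 (P.fst w) (P.fst v)
      + P.snd v • h7 (P.fst u) (P.fst w) + (P.snd v * P.snd w) • h8 (P.fst u)
      - (P.snd u * P.snd v) • h8 (P.fst w)

theorem eq_zero_of_perfect
    (hperf : Submodule.span K {c : A | ∃ a b : A, c = circ a b - circ b a} = ⊤)
    {f : A →ₗ[K] K} (hf : ∀ a b, f (circ a b) = f (circ b a)) : f = 0 := by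
  refine LinearMap.ext_on hperf ?_
  rintro _ ⟨a, b, rfl⟩
  simp [hf a b]

theorem GDStrEquiv.equivalence : Equivalence (GDStrEquiv A circ brk) where
  refl s := ⟨LinearEquiv.refl K E, by simp, by simp, by simp⟩
  symm := by
    rintro s s' ⟨φ, h1, h2, h3⟩
    exact ⟨φ.symm, fun u v => φ.injective (by simp [h1]), fun u v => φ.injective (by simp [h2]),
      fun a => φ.injective (by simp [h3])⟩
  trans := by
    rintro s s' s'' ⟨φ, h1, h2, h3⟩ ⟨ψ, g1, g2, g3⟩
    exact ⟨φ.trans ψ, by simp [h1, g1], by simp [h2, g2], by simp [h3, g3]⟩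

/-- Perfectness and innerness of quasicentroids let one choose the complement of `A` so that
left multiplication by `A` annihilates it. -/
theorem exists_mul_sub_eq_zero (P : Splitting A x)
    (hperf : Submodule.span K {c : A | ∃ a b : A, c = circ a b - circ b a} = ⊤)
    (hqc : ∀ T : A →ₗ[K] A,
      ((∀ a b : A, T (circ a b) = circ (T a) b) ∧
       (∀ a b : A, T (circ a b) - T (circ b a) = circ a (T b) - circ b (T a))) →
      ∃ b0 : A, ∀ a : A, T a = circ a b0)
    {m br : E →ₗ[K] E →ₗ[K] E} (hm : IsGD (fun u v => m u v) (fun u v => br u v))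
    (hmA : ∀ a b : A, m a b = (circ a b : A)) :
    ∃ b : A, ∀ a : A, m a (x - (b : E)) = 0 := by
  obtain ⟨⟨n1, n2⟩, -, -⟩ := hm
  simp only at n1 n2
  set p : A →ₗ[K] K := P.snd ∘ₗ m.flip x ∘ₗ A.subtype with hp
  set T : A →ₗ[K] A := P.fst ∘ₗ m.flip x ∘ₗ A.subtype with hT
  have hax (a : A) : m a x = (T a : E) + p a • x := by simpa [hp, hT] using P.eq_add (m a x)
  have hp0 : p = 0 := by
    refine eq_zero_of_perfect hperf fun a b => ?_
    have h := congrArg P.snd (n1 a b x)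
    simp [hmA, hax] at h
    linear_combination h
  simp only [hp0, LinearMap.zero_apply, zero_smul, add_zero] at hax
  have hT1 (a b : A) : T (circ a b) = circ (T a) b := by
    have h := congrArg P.fst (n2 a b x)
    simpa [hmA, hax] using h
  have hT2 (a b : A) : T (circ a b) - T (circ b a) = circ a (T b) - circ b (T a) := by
    have h := congrArg P.fst (n1 a b x)
    simp [hmA, hax] at h
    linear_combination (norm := module) h
  obtain ⟨b0, hb0⟩ := hqc T ⟨hT1, hT2⟩
  exact ⟨b0, fun a => by simp [hax, hmA, hb0]⟩

theorem exists_isFlagDatum_of_mul_eq_zero (P : Splitting A x)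
    (hperf : Submodule.span K {c : A | ∃ a b : A, c = circ a b - circ b a} = ⊤)
    {m br : E →ₗ[K] E →ₗ[K] E} (hm : IsGD (fun u v => m u v) (fun u v => br u v))
    (hmA : ∀ a b : A, m a b = (circ a b : A)) (hbA : ∀ a b : A, br a b = (brk a b : A))
    (hax : ∀ a : A, m a x = 0) :
    ∃ (S D : A →ₗ[K] A) (a1 : A) (k : K), IsFlagDatum circ brk ⟨0, 0, S, 0, a1, k, 0, D⟩ ∧
      (∀ a : A, m x a = S a) ∧ m x x = (a1 : E) + k • x ∧ ∀ a : A, br x a = D a := by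
  obtain ⟨⟨n1, n2⟩, ⟨l1, l2⟩, g⟩ := hm
  simp only at n1 n2 l1 l2 g
  have hsw (u v : E) : br u v = -br v u := by
    have h := l1 (u + v)
    simp only [map_add, LinearMap.add_apply, l1, zero_add, add_zero] at h
    linear_combination (norm := module) h
  set q : A →ₗ[K] K := P.snd ∘ₗ m x ∘ₗ A.subtype with hq
  set η : A →ₗ[K] K := P.snd ∘ₗ br x ∘ₗ A.subtype with hη
  set S : A →ₗ[K] A := P.fst ∘ₗ m x ∘ₗ A.subtype with hS
  set D : A →ₗ[K] A := P.fst ∘ₗ br x ∘ₗ A.subtype with hD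
  have hxa (a : A) : m x a = (S a : E) + q a • x := by simpa [hq, hS] using P.eq_add (m x a)
  have hbxa (a : A) : br x a = (D a : E) + η a • x := by simpa [hη, hD] using P.eq_add (br x a)
  have hq0 : q = 0 := by
    refine eq_zero_of_perfect hperf fun a b => ?_
    have h1 := congrArg P.snd (n1 a x b)
    have h2 := congrArg P.snd (n1 b x a)
    simp [hmA, hax, hxa] at h1 h2
    linear_combination h1 - h2
  simp only [hq0, LinearMap.zero_apply, zero_smul, add_zero] at hxa
  have hη0 : η = 0 := by
    have h (a b : A) : η (circ a b) = 0 := by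
      have h := congrArg P.snd (g b a x)
      rw [hsw b x, hsw a x] at h
      simpa [hmA, hax, hxa, hbA, hbxa] using h
    exact eq_zero_of_perfect hperf fun a b => by rw [h, h]
  simp only [hη0, LinearMap.zero_apply, zero_smul, add_zero] at hbxa
  set a1 : A := P.fst (m x x) with ha1
  set k : K := P.snd (m x x) with hk
  have hxx : m x x = (a1 : E) + k • x := P.eq_add _
  have hbax (a : A) : br a x = -(D a : E) := by rw [hsw, hbxa]
  refine ⟨S, D, a1, k, (isFlagDatum_of_eq_zero_iff ..).2
    ⟨fun a b => ?_, fun a => ?_, fun a b => ?_, fun a => ?_, fun a b => ?_, fun a b => ?_,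
      fun a b => ?_, fun a => ?_⟩, hxa, hxx, hbxa⟩
  · have h := congrArg P.fst (n1 x a b)
    simp [hmA, hax, hxa] at h
    linear_combination (norm := module) -h
  · have h := congrArg P.fst (n1 a x x)
    simpa [hmA, hax, hxa, hxx] using h
  · have h := congrArg P.fst (n2 x a b)
    simpa [hmA, hax, hxa] using h
  · have h := congrArg P.fst (n2 x x a)
    simpa [hmA, hax, hxa, hxx] using h
  · have h := congrArg P.fst (l2 x a b)
    simpa [hbA, hbxa] using h
  · have h := congrArg P.fst (g a b x)
    simp [hmA, hax, hbA, hbxa, hbax] at h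
    linear_combination (norm := module) -h
  · have h := congrArg P.fst (g a x b)
    simpa [hmA, hxa, hbA, hbxa, hbax] using h
  · have h := congrArg P.fst (g a x x)
    simp [hax, hxa, hxx, hbA, hbxa, hbax, l1] at h
    linear_combination (norm := module) h

section

variable (P : Splitting A x) (d : FlagData K A)

@[simp]
theorem extMul_coe_coe (a b : A) : extMul P circ d a b = (circ a b : A) := by simp [extMul]

@[simp]
theorem extMul_coe_self (a : A) : extMul P circ d a x = 0 := by simp [extMul]

@[simp]
theorem extMul_self_coe (a : A) : extMul P circ d x a = d.S a := by simp [extMul]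

@[simp]
theorem extMul_self_self : extMul P circ d x x = (d.a1 : E) + d.k • x := by simp [extMul]

@[simp]
theorem extBr_coe_coe (a b : A) : extBr P brk d a b = (brk a b : A) := by simp [extBr]

@[simp]
theorem extBr_coe_self (a : A) : extBr P brk d a x = -(d.D a : E) := by simp [extBr]

@[simp]
theorem extBr_self_coe (a : A) : extBr P brk d x a = d.D a := by simp [extBr]

@[simp]
theorem extBr_self_self : extBr P brk d x x = 0 := by simp [extBr]

end

variable (circ brk) in
/-- The Gel'fand-Dorfman flag data with `p = q = η = 0` and `T = 0`. -/
abbrev ReducedFlagDatum : Type _ :=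
  {d : FlagData K A // IsFlagDatum circ brk d ∧ d.p = 0 ∧ d.q = 0 ∧ d.eta = 0 ∧ d.T = 0}

/-- The GD bialgebra structure on `E` determined by a reduced flag datum. -/
def extStr (P : Splitting A x) (hGD : IsGD (fun a b => circ a b) (fun a b => brk a b))
    (d : ReducedFlagDatum circ brk) : GDStrOn A circ brk :=
  ⟨(extMul P circ d.1, extBr P brk d.1), by
    obtain ⟨⟨p, q, S, T, a1, k, η, D⟩, h, hp, hq, hη, hT⟩ := d
    dsimp only at hp hq hη hT
    subst hp hq hη hT
    exact ⟨isGD_ext P hGD h, fun a b => ⟨extMul_coe_coe .., extBr_coe_coe ..⟩⟩⟩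

/-- Equivalence of reduced flag data. -/
def ReducedFlagDatum.Equiv (d d' : ReducedFlagDatum circ brk) : Prop :=
  ∃ (a0 : A) (β : K), β ≠ 0 ∧
    (∀ a : A, d.1.S a = circ a0 a + β • d'.1.S a) ∧
    (∀ a : A, circ a a0 = 0) ∧
    (d.1.a1 = circ a0 a0 + β • d'.1.S a0 + (β * β) • d'.1.a1 - d.1.k • a0) ∧
    (d.1.k = β * d'.1.k) ∧
    (∀ a : A, d.1.D a = β • d'.1.D a + brk a0 a)

theorem gdStrEquiv_extStr_iff (P : Splitting A x)
    (hGD : IsGD (fun a b => circ a b) (fun a b => brk a b)) (d d' : ReducedFlagDatum circ brk) :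
    GDStrEquiv A circ brk (extStr P hGD d) (extStr P hGD d') ↔ d.Equiv d' := by
  have hsw := brk_swap hGD
  have hll := hGD.2.1.1
  simp only at hll
  constructor
  · rintro ⟨φ, hmul, hbr, hA⟩
    set a0 := P.fst (φ x) with ha0
    set β := P.snd (φ x) with hβ
    have hφ : φ x = (a0 : E) + β • x := P.eq_add _
    have hβ0 : β ≠ 0 := by
      intro h
      rw [h, zero_smul, add_zero, ← hA a0] at hφ
      have := congrArg P.snd (φ.injective hφ)
      simp at this
    dsimp only [extStr] at hmul hbr
    refine ⟨a0, β, hβ0, fun a => ?_, fun a => ?_, ?_, ?_, fun a => ?_⟩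
    · have h := congrArg P.fst (hmul x a)
      simpa [hφ, hA] using h
    · have h := congrArg P.fst (hmul a x)
      simpa [hφ, hA, eq_comm] using h
    · have h := congrArg P.fst (hmul x x)
      simp [hφ, hA] at h
      linear_combination (norm := module) h
    · have h := congrArg P.snd (hmul x x)
      simp [hφ, hA] at h
      exact mul_right_cancel₀ hβ0 (by linear_combination h)
    · have h := congrArg P.fst (hbr x a)
      simpa [hφ, hA, add_comm] using h
  · rintro ⟨a0, β, hβ, hS, h0, ha1, hk, hD⟩
    refine ⟨P.affineEquiv a0 hβ, fun u v => ?_, fun u v => ?_, P.affineEquiv_coe a0 hβ⟩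
    · refine P.linearMap_ext₂
        (f := (extMul P circ d.1).compr₂ (P.affineEquiv a0 hβ).toLinearMap)
        (g := (extMul P circ d'.1).compl₁₂ (P.affineEquiv a0 hβ).toLinearMap
          (P.affineEquiv a0 hβ).toLinearMap) (fun a b => ?_) (fun a => ?_) (fun a => ?_) ?_ u v
      · simp
      · simp [h0]
      · simp [hS]
      · simp [ha1, hk, h0]
        module
    · refine P.linearMap_ext₂
        (f := (extBr P brk d.1).compr₂ (P.affineEquiv a0 hβ).toLinearMap)
        (g := (extBr P brk d'.1).compl₁₂ (P.affineEquiv a0 hβ).toLinearMap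
          (P.affineEquiv a0 hβ).toLinearMap) (fun a b => ?_) (fun a => ?_) (fun a => ?_) ?_ u v
      · simp
      · simp [hD, hsw a a0]
      · simp [hD, add_comm]
      · simp [hll]

theorem exists_gdStrEquiv_extStr (P : Splitting A x)
    (hGD : IsGD (fun a b => circ a b) (fun a b => brk a b))
    (hperf : Submodule.span K {c : A | ∃ a b : A, c = circ a b - circ b a} = ⊤)
    (hqc : ∀ T : A →ₗ[K] A,
      ((∀ a b : A, T (circ a b) = circ (T a) b) ∧
       (∀ a b : A, T (circ a b) - T (circ b a) = circ a (T b) - circ b (T a))) →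
      ∃ b0 : A, ∀ a : A, T a = circ a b0)
    (s : GDStrOn A circ brk) :
    ∃ d : ReducedFlagDatum circ brk, GDStrEquiv A circ brk (extStr P hGD d) s := by
  obtain ⟨⟨m, br⟩, hs, hsA⟩ := s
  obtain ⟨b, hb⟩ := exists_mul_sub_eq_zero P hperf hqc hs fun a b => (hsA a b).1
  obtain ⟨S, D, a1, k, hd, hxa, hxx, hbxa⟩ := exists_isFlagDatum_of_mul_eq_zero (P.shift b) hperf hs
    (fun a b => (hsA a b).1) (fun a b => (hsA a b).2) hb
  have l1 := hs.2.1.1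
  have hsw (u v : E) : br u v = -br v u := by
    have h := l1 (u + v)
    simp only at l1
    simp only [map_add, LinearMap.add_apply, l1, zero_add, add_zero] at h
    linear_combination (norm := module) h
  have hφ : P.affineEquiv (-b) (one_ne_zero (α := K)) x = x - (b : E) := by
    simp [neg_add_eq_sub]
  set φ := P.affineEquiv (-b) (one_ne_zero (α := K)) with hφd
  have hφA (a : A) : φ a = a := P.affineEquiv_coe ..
  refine ⟨⟨⟨0, 0, S, 0, a1, k, 0, D⟩, hd, rfl, rfl, rfl, rfl⟩, φ, fun u v => ?_, fun u v => ?_, hφA⟩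
  · refine P.linearMap_ext₂
      (f := (extMul P circ ⟨0, 0, S, 0, a1, k, 0, D⟩).compr₂ φ.toLinearMap)
      (g := m.compl₁₂ φ.toLinearMap φ.toLinearMap)
      (fun a b => ?_) (fun a => ?_) (fun a => ?_) ?_ u v
    all_goals
      simp only [LinearMap.compr₂_apply, LinearMap.compl₁₂_apply, LinearEquiv.coe_coe, hφ, hφA,
        extMul_coe_coe, extMul_coe_self, extMul_self_coe, extMul_self_self, map_add, map_smul,
        map_zero, hb, hxa, hxx, (hsA _ _).1]
  · refine P.linearMap_ext₂
      (f := (extBr P brk ⟨0, 0, S, 0, a1, k, 0, D⟩).compr₂ φ.toLinearMap)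
      (g := br.compl₁₂ φ.toLinearMap φ.toLinearMap)
      (fun a b => ?_) (fun a => ?_) (fun a => ?_) ?_ u v
    · simp [hφA, (hsA _ _).2]
    · simp only [LinearMap.compr₂_apply, LinearMap.compl₁₂_apply, LinearEquiv.coe_coe, hφ, hφA,
        extBr_coe_self, map_neg, hsw a, hbxa]
    · simp only [LinearMap.compr₂_apply, LinearMap.compl₁₂_apply, LinearEquiv.coe_coe, hφ, hφA,
        extBr_self_coe, hbxa]
    · simp only [LinearMap.compr₂_apply, LinearMap.compl₁₂_apply, LinearEquiv.coe_coe, hφ,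
        extBr_self_self, map_zero]
      exact (l1 _).symm

end Extension

/-- Corollary, part 1: if the sub-adjacent Lie algebra of `(A,∘)` is perfect
and every quasicentroid of `(A,∘)` is inner, then `Extd(E,A)` is in bijection with
`(SF1(A)/≡) ⊔ (SF3(A)/≡)`. -/
theorem extd_bijection_SF1_SF3
    {K E : Type*} [Field K] [AddCommGroup E] [Module K E]
    (A : Submodule K E) (x : E) (hx : x ∉ A) (hc : IsCompl A (K ∙ x))
    (circ brk : ↥A →ₗ[K] ↥A →ₗ[K] ↥A)
    (hGD : IsGD (fun a b => circ a b) (fun a b => brk a b))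
    -- the sub-adjacent Lie algebra g(A) is perfect
    (hperf : Submodule.span K {c : ↥A | ∃ a b : ↥A, c = circ a b - circ b a} = ⊤)
    -- every quasicentroid of (A, ∘) is inner
    (hqc : ∀ T : ↥A →ₗ[K] ↥A,
      ((∀ a b : ↥A, T (circ a b) = circ (T a) b) ∧
       (∀ a b : ↥A, T (circ a b) - T (circ b a) = circ a (T b) - circ b (T a))) →
      ∃ b0 : ↥A, ∀ a : ↥A, T a = circ a b0) :
    Nonempty
      ((Quot (fun d d' : {d : FlagData K ↥A // IsFlagDatum circ brk d ∧
                 d.p = 0 ∧ d.q = 0 ∧ d.eta = 0 ∧ d.T = 0} =>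
          -- equivalence on SF1(A)
          ∃ (a0 : ↥A) (β : K), β ≠ 0 ∧
            (∀ a : ↥A, d.1.S a = circ a0 a + β • d'.1.S a) ∧
            (∀ a : ↥A, circ a a0 = 0) ∧
            (d.1.a1 = circ a0 a0 + β • d'.1.S a0 + (β * β) • d'.1.a1 - d.1.k • a0) ∧
            (d.1.k = β * d'.1.k) ∧
            (∀ a : ↥A, d.1.D a = β • d'.1.D a + brk a0 a))
        ⊕
        Quot (fun d d' : {d : FlagData K ↥A // IsFlagDatum circ brk d ∧
                 d.p = 0 ∧ d.T = 0 ∧ d.k = 0 ∧ d.q ≠ 0} =>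
          -- equivalence on SF3(A)
          d.1.q = d'.1.q ∧ d.1.eta = d'.1.eta ∧
          ∃ (a0 : ↥A) (β : K), β ≠ 0 ∧
            (∀ a : ↥A, d.1.S a = circ a0 a + β • d'.1.S a - d.1.q a • a0) ∧
            (∀ a : ↥A, circ a a0 = 0) ∧
            (d.1.a1 = circ a0 a0 + β • d'.1.S a0 + (β * β) • d'.1.a1) ∧
            (d.1.q a0 = 0) ∧
            (∀ a : ↥A, d.1.D a = β • d'.1.D a + brk a0 a - d.1.eta a • a0)))
      ≃ Quot (GDStrEquiv A circ brk)) := by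
  obtain ⟨P⟩ := nonempty_splitting hx hc
  have hempty : IsEmpty {d : FlagData K ↥A // IsFlagDatum circ brk d ∧
      d.p = 0 ∧ d.T = 0 ∧ d.k = 0 ∧ d.q ≠ 0} :=
    ⟨fun d => d.2.2.2.2.2 (eq_zero_of_perfect hperf fun a b => by
      rw [d.2.1.2.1, d.2.1.2.1, mul_comm])⟩
  let F : Quot (ReducedFlagDatum.Equiv (circ := circ) (brk := brk)) →
      Quot (GDStrEquiv A circ brk) :=
    Quot.map (extStr P hGD) fun d d' => (gdStrEquiv_extStr_iff P hGD d d').2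
  have hF : Function.Bijective F := by
    refine ⟨?_, ?_⟩
    · rintro ⟨d⟩ ⟨d'⟩ h
      exact Quot.sound ((gdStrEquiv_extStr_iff P hGD d d').1
        ((Quot.eq.trans GDStrEquiv.equivalence.eqvGen_iff).1 h))
    · rintro ⟨s⟩
      obtain ⟨d, hd⟩ := exists_gdStrEquiv_extStr P hGD hperf hqc s
      exact ⟨Quot.mk _ d, Quot.sound hd⟩
  have hquot (r) : IsEmpty (Quot (α := {d : FlagData K ↥A // IsFlagDatum circ brk d ∧
      d.p = 0 ∧ d.T = 0 ∧ d.k = 0 ∧ d.q ≠ 0}) r) := ⟨fun z => hempty.elim z.exists_rep.choose⟩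
  exact ⟨(@Equiv.sumEmpty _ _ (hquot _)).trans (Equiv.ofBijective F hF)⟩

end GDExt
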